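/- (Theorem 4.3) Let G be an IMM execution graph with whole serial numbers, and let G_a be an ARM execution graph that corresponds to G (in the sense of the compilation correspondence below). Then ARM-consistency of G_a implies IMM-consistency of G. -/

import Mathlib

/-! ## Basic definitions: events, labels, relations -/

abbrev Loc := ℕ
abbrev Val := ℕ

inductive Mode
  | rlx | acq | rel | acqrel | sc
deriving DecidableEq

inductive ExFlag
  | notex | ex
deriving DecidableEq

inductive Strength
  | normal | strong
deriving DecidableEq

inductive Label
  | read (o : Mode) (x : Loc) (v : Val) (s : ExFlag)
  | write (o : Mode) (x : Loc) (v : Val) (st : Strength)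
  | fence (o : Mode)
deriving DecidableEq

inductive Event
  | init (x : Loc)
  | ev (tid : ℕ) (sn : ℚ)
deriving DecidableEq

def Event.isInit : Event → Prop
  | .init _ => True
  | .ev _ _ => False

/-- the set of initialization events -/
def InitE : Set Event := {e | e.isInit}

/-- the `sequenced-before` partial order on events: initialization events precede all
non-initialization events, and events of the same thread are ordered by serial number -/
def evLt : Event → Event → Prop
  | .init _, .ev _ _ => True
  | .ev i n, .ev j m => i = j ∧ n < m
  | _, _ => False

abbrev REv := Event → Event → Prop

/-- relational composition `r ; s` -/
def seqR (r s : REv) : REv := fun a c => ∃ b, r a b ∧ s b c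

infixr:70 " ⬝ " => seqR

/-- identity relation on a set: `[A]` -/
def eqv (A : Set Event) : REv := fun a b => a = b ∧ a ∈ A

notation:max "⦗" A "⦘" => eqv A

/-- union of relations -/
def runion (r s : REv) : REv := fun a b => r a b ∨ s a b

infixl:65 " ∪ᵣ " => runion

/-- reflexive closure `r^?` -/
def rcl (r : REv) : REv := fun a b => a = b ∨ r a b

/-- transitive closure `r⁺` -/
def tcl (r : REv) : REv := Relation.TransGen r

/-- reflexive-transitive closure `r*` -/
def rtcl (r : REv) : REv := Relation.ReflTransGen r

/-- inverse relation `r⁻¹` -/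
def transp (r : REv) : REv := fun a b => r b a

def rdom (r : REv) : Set Event := {a | ∃ b, r a b}

def rcodom (r : REv) : Set Event := {b | ∃ a, r a b}

/-- immediate edges: `imm(r) = r ∖ r;r` -/
def immediate (r : REv) : REv := fun a b => r a b ∧ ¬ (r ⬝ r) a b

def acyclic (r : REv) : Prop := Irreflexive (tcl r)

/-- `r` totally orders `A` -/
def totalOn (A : Set Event) (r : REv) : Prop :=
  ∀ a ∈ A, ∀ b ∈ A, a ≠ b → r a b ∨ r b a

def Label.locOf : Label → Option Loc
  | .read _ x _ _ => some x
  | .write _ x _ _ => some x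
  | .fence _ => none

def Label.valOf : Label → Option Val
  | .read _ _ v _ => some v
  | .write _ _ v _ => some v
  | .fence _ => none

/-! ## IMM execution graphs -/

structure Execution where
  E : Set Event
  lab : Event → Label
  rmw : REv
  data : REv
  addr : REv
  ctrl : REv
  casdep : REv
  rf : REv
  co : REv

namespace Execution

variable (G : Execution)

def loc (e : Event) : Option Loc := (G.lab e).locOf
def valu (e : Event) : Option Val := (G.lab e).valOf

/-- read events -/
def R : Set Event := {e | e ∈ G.E ∧ ∃ o x v s, G.lab e = .read o x v s}
/-- write events -/
def W : Set Event := {e | e ∈ G.E ∧ ∃ o x v st, G.lab e = .write o x v st}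
/-- fence events -/
def F : Set Event := {e | e ∈ G.E ∧ ∃ o, G.lab e = .fence o}
/-- acquire reads -/
def Racq : Set Event := {e | e ∈ G.E ∧ ∃ x v s, G.lab e = .read .acq x v s}
/-- exclusive reads -/
def Rex : Set Event := {e | e ∈ G.E ∧ ∃ o x v, G.lab e = .read o x v .ex}
/-- release writes -/
def Wrel : Set Event := {e | e ∈ G.E ∧ ∃ x v st, G.lab e = .write .rel x v st}
/-- strong writes -/
def Wstrong : Set Event := {e | e ∈ G.E ∧ ∃ o x v, G.lab e = .write o x v .strong}
/-- writes to location `x` -/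
def Wloc (x : Loc) : Set Event := {e | e ∈ G.W ∧ G.loc e = some x}
/-- reads from location `x` -/
def Rloc (x : Loc) : Set Event := {e | e ∈ G.R ∧ G.loc e = some x}
/-- SC fences -/
def Fsc : Set Event := {e | e ∈ G.E ∧ G.lab e = .fence .sc}
/-- fences of mode exactly `rel` -/
def Frel : Set Event := {e | e ∈ G.E ∧ G.lab e = .fence .rel}
/-- fences whose mode is at least `rel` (i.e. `rel`, `acqrel` or `sc`) -/
def FgeRel : Set Event :=
  {e | e ∈ G.E ∧ (G.lab e = .fence .rel ∨ G.lab e = .fence .acqrel ∨ G.lab e = .fence .sc)}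
/-- fences whose mode is at least `acq` (i.e. `acq`, `acqrel` or `sc`) -/
def FgeAcq : Set Event :=
  {e | e ∈ G.E ∧ (G.lab e = .fence .acq ∨ G.lab e = .fence .acqrel ∨ G.lab e = .fence .sc)}

/-- program order -/
def po : REv := fun a b => a ∈ G.E ∧ b ∈ G.E ∧ evLt a b

/-- both events access the same location -/
def sameLoc : REv := fun a b => ∃ x, G.loc a = some x ∧ G.loc b = some x

/-- `po|loc` -/
def poloc : REv := fun a b => G.po a b ∧ G.sameLoc a b

def rfi : REv := fun a b => G.rf a b ∧ G.po a b
def rfe : REv := fun a b => G.rf a b ∧ ¬ G.po a b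
def coi : REv := fun a b => G.co a b ∧ G.po a b
def coe : REv := fun a b => G.co a b ∧ ¬ G.po a b

/-- from-read -/
def fr : REv := transp G.rf ⬝ G.co
def fri : REv := fun a b => G.fr a b ∧ G.po a b
def fre : REv := fun a b => G.fr a b ∧ ¬ G.po a b

/-- release sequence -/
def rs : REv :=
  ⦗G.W⦘ ⬝ G.poloc ⬝ ⦗G.W⦘ ∪ᵣ ⦗G.W⦘ ⬝ rtcl (rcl G.poloc ⬝ G.rf ⬝ G.rmw)

/-- release prefix -/
def release : REv := (⦗G.Wrel⦘ ∪ᵣ ⦗G.FgeRel⦘ ⬝ G.po) ⬝ G.rs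

/-- synchronizes with -/
def sw : REv :=
  G.release ⬝ (G.rfi ∪ᵣ rcl G.poloc ⬝ G.rfe) ⬝ (⦗G.Racq⦘ ∪ᵣ G.po ⬝ ⦗G.FgeAcq⦘)

/-- happens-before -/
def hb : REv := tcl (G.po ∪ᵣ G.sw)

/-- extended coherence order -/
def eco : REv := G.rf ∪ᵣ G.co ⬝ rcl G.rf ∪ᵣ G.fr ⬝ rcl G.rf

/-- barrier order -/
def bob : REv :=
  G.po ⬝ ⦗G.Wrel⦘ ∪ᵣ ⦗G.Racq⦘ ⬝ G.po ∪ᵣ G.po ⬝ ⦗G.F⦘ ∪ᵣ ⦗G.F⦘ ⬝ G.po ∪ᵣ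
    ⦗G.Wrel⦘ ⬝ G.poloc ⬝ ⦗G.W⦘

/-- syntactic dependencies -/
def deps : REv :=
  G.data ∪ᵣ G.ctrl ∪ᵣ G.addr ⬝ rcl G.po ∪ᵣ G.casdep ∪ᵣ ⦗G.Rex⦘ ⬝ G.po

/-- preserved program order -/
def ppo : REv := ⦗G.R⦘ ⬝ tcl (G.deps ∪ᵣ G.rfi) ⬝ ⦗G.W⦘

def detour : REv := fun a b => (G.coe ⬝ G.rfe) a b ∧ G.po a b

/-- partial SC fence order -/
def psc : REv := ⦗G.Fsc⦘ ⬝ G.hb ⬝ G.eco ⬝ G.hb ⬝ ⦗G.Fsc⦘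

/-- the acyclicity relation of IMM -/
def ar : REv :=
  G.rfe ∪ᵣ G.bob ∪ᵣ G.ppo ∪ᵣ G.detour ∪ᵣ G.psc ∪ᵣ ⦗G.Wstrong⦘ ⬝ G.po ⬝ ⦗G.W⦘

/-! RC11-style variants -/

def rsRC11 : REv := ⦗G.W⦘ ⬝ rcl G.poloc ⬝ rtcl (G.rf ⬝ G.rmw)

def releaseRC11 : REv := (⦗G.Wrel⦘ ∪ᵣ ⦗G.FgeRel⦘ ⬝ G.po) ⬝ G.rsRC11

def swRC11 : REv := G.releaseRC11 ⬝ G.rf ⬝ (⦗G.Racq⦘ ∪ᵣ G.po ⬝ ⦗G.FgeAcq⦘)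

def hbRC11 : REv := tcl (G.po ∪ᵣ G.swRC11)

end Execution

/-- Well-formedness of an IMM execution graph -/
structure ExecWf (G : Execution) : Prop where
  finE : G.E.Finite
  init_lab : ∀ x, Event.init x ∈ G.E →
    G.lab (Event.init x) = Label.write .rlx x 0 .normal
  read_mode : ∀ e ∈ G.E, ∀ o x v s, G.lab e = .read o x v s → o = Mode.rlx ∨ o = Mode.acq
  write_mode : ∀ e ∈ G.E, ∀ o x v st, G.lab e = .write o x v st → o = Mode.rlx ∨ o = Mode.rel
  fence_mode : ∀ e ∈ G.E, ∀ o, G.lab e = .fence o →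
    o = Mode.acq ∨ o = Mode.rel ∨ o = Mode.acqrel ∨ o = Mode.sc
  rmw_sub : ∀ a b, G.rmw a b → a ∈ G.Rex ∧ b ∈ G.W ∧ G.sameLoc a b ∧ immediate G.po a b
  strong_rmw : G.Wstrong ⊆ rcodom G.rmw
  data_sub : ∀ a b, G.data a b → a ∈ G.R ∧ G.po a b ∧ b ∈ G.W
  addr_sub : ∀ a b, G.addr a b → a ∈ G.R ∧ G.po a b ∧ (b ∈ G.R ∨ b ∈ G.W)
  ctrl_sub : ∀ a b, G.ctrl a b → a ∈ G.R ∧ G.po a b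
  ctrl_po : ∀ a b c, G.ctrl a b → G.po b c → G.ctrl a c
  casdep_sub : ∀ a b, G.casdep a b → a ∈ G.R ∧ G.po a b ∧ b ∈ G.Rex
  rf_sub : ∀ a b, G.rf a b → a ∈ G.W ∧ b ∈ G.R ∧ G.sameLoc a b
  rf_val : ∀ a b, G.rf a b → G.valu a = G.valu b
  rf_func : ∀ a b c, G.rf a c → G.rf b c → a = b
  co_sub : ∀ a b, G.co a b → a ∈ G.W ∧ b ∈ G.W ∧ G.sameLoc a b
  co_trans : Transitive G.co
  co_irr : Irreflexive G.co

/-- IMM-consistency (Definition 3.1) -/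
def IMMConsistent (G : Execution) : Prop :=
  rcodom G.rf = G.R ∧
  (∀ x, totalOn (G.Wloc x) G.co) ∧
  Irreflexive (G.hb ⬝ rcl G.eco) ∧
  (∀ a b, G.rmw a b → ¬ (G.fre ⬝ G.coe) a b) ∧
  acyclic G.ar

/-! ## ARMv8 execution graphs -/

inductive ARMode
  | rlx | q
deriving DecidableEq

inductive AWMode
  | rlx | l
deriving DecidableEq

inductive AFMode
  | ld | sy
deriving DecidableEq

inductive ALabel
  | read (o : ARMode) (x : Loc) (v : Val)
  | write (o : AWMode) (x : Loc) (v : Val)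
  | fence (o : AFMode)
deriving DecidableEq

structure AExec where
  E : Set Event
  lab : Event → ALabel
  rmw : REv
  data : REv
  addr : REv
  ctrl : REv
  rf : REv
  co : REv

namespace AExec

variable (Ga : AExec)

def loc (e : Event) : Option Loc :=
  match Ga.lab e with
  | .read _ x _ => some x
  | .write _ x _ => some x
  | .fence _ => none

def valu (e : Event) : Option Val :=
  match Ga.lab e with
  | .read _ _ v => some v
  | .write _ _ v => some v
  | .fence _ => none

def R : Set Event := {e | e ∈ Ga.E ∧ ∃ o x v, Ga.lab e = .read o x v}
def W : Set Event := {e | e ∈ Ga.E ∧ ∃ o x v, Ga.lab e = .write o x v}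
/-- acquire (`Q`) reads -/
def RQ : Set Event := {e | e ∈ Ga.E ∧ ∃ x v, Ga.lab e = .read .q x v}
/-- release (`L`) writes -/
def WL : Set Event := {e | e ∈ Ga.E ∧ ∃ x v, Ga.lab e = .write .l x v}
def Fld : Set Event := {e | e ∈ Ga.E ∧ Ga.lab e = .fence .ld}
def Fsy : Set Event := {e | e ∈ Ga.E ∧ Ga.lab e = .fence .sy}
def Wloc (x : Loc) : Set Event := {e | e ∈ Ga.W ∧ Ga.loc e = some x}
/-- exclusive writes -/
def Wex : Set Event := rcodom Ga.rmw

def po : REv := fun a b => a ∈ Ga.E ∧ b ∈ Ga.E ∧ evLt a b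
def sameLoc : REv := fun a b => ∃ x, Ga.loc a = some x ∧ Ga.loc b = some x
def poloc : REv := fun a b => Ga.po a b ∧ Ga.sameLoc a b
def rfi : REv := fun a b => Ga.rf a b ∧ Ga.po a b
def rfe : REv := fun a b => Ga.rf a b ∧ ¬ Ga.po a b
def coi : REv := fun a b => Ga.co a b ∧ Ga.po a b
def coe : REv := fun a b => Ga.co a b ∧ ¬ Ga.po a b
def fr : REv := transp Ga.rf ⬝ Ga.co
def fri : REv := fun a b => Ga.fr a b ∧ Ga.po a b
def fre : REv := fun a b => Ga.fr a b ∧ ¬ Ga.po a b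

/-- observed-by -/
def obs : REv := Ga.rfe ∪ᵣ Ga.fre ∪ᵣ Ga.coe

/-- dependency-ordered-before -/
def dob : REv :=
  (Ga.addr ∪ᵣ Ga.data) ⬝ rcl Ga.rfi ∪ᵣ
    (Ga.ctrl ∪ᵣ Ga.data) ⬝ ⦗Ga.W⦘ ⬝ rcl Ga.coi ∪ᵣ
    Ga.addr ⬝ Ga.po ⬝ ⦗Ga.W⦘

/-- atomic-ordered-before -/
def aob : REv := Ga.rmw ∪ᵣ ⦗Ga.Wex⦘ ⬝ Ga.rfi ⬝ ⦗Ga.RQ⦘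

/-- barrier-ordered-before -/
def boba : REv :=
  Ga.po ⬝ ⦗Ga.Fsy⦘ ⬝ Ga.po ∪ᵣ ⦗Ga.R⦘ ⬝ Ga.po ⬝ ⦗Ga.Fld⦘ ⬝ Ga.po ∪ᵣ
    ⦗Ga.RQ⦘ ⬝ Ga.po ∪ᵣ Ga.po ⬝ ⦗Ga.WL⦘ ⬝ rcl Ga.coi

end AExec

/-- Well-formedness of an ARM execution graph. -/
structure AExecWf (Ga : AExec) : Prop where
  finE : Ga.E.Finite
  rmw_sub : ∀ a b, Ga.rmw a b → a ∈ Ga.R ∧ b ∈ Ga.W ∧ Ga.sameLoc a b ∧ immediate Ga.po a b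
  data_sub : ∀ a b, Ga.data a b → a ∈ Ga.R ∧ Ga.po a b ∧ b ∈ Ga.W
  addr_sub : ∀ a b, Ga.addr a b → a ∈ Ga.R ∧ Ga.po a b ∧ (b ∈ Ga.R ∨ b ∈ Ga.W)
  ctrl_sub : ∀ a b, Ga.ctrl a b → a ∈ Ga.R ∧ Ga.po a b
  ctrl_po : ∀ a b c, Ga.ctrl a b → Ga.po b c → Ga.ctrl a c
  rf_sub : ∀ a b, Ga.rf a b → a ∈ Ga.W ∧ b ∈ Ga.R ∧ Ga.sameLoc a b
  rf_val : ∀ a b, Ga.rf a b → Ga.valu a = Ga.valu b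
  rf_func : ∀ a b c, Ga.rf a c → Ga.rf b c → a = b
  co_sub : ∀ a b, Ga.co a b → a ∈ Ga.W ∧ b ∈ Ga.W ∧ Ga.sameLoc a b
  co_trans : Transitive Ga.co
  co_irr : Irreflexive Ga.co

/-- ARM-consistency (Definition C.1). -/
def ARMConsistent (Ga : AExec) : Prop :=
  rcodom Ga.rf = Ga.R ∧
  (∀ x, totalOn (Ga.Wloc x) Ga.co) ∧
  acyclic (Ga.poloc ∪ᵣ Ga.rf ∪ᵣ Ga.fr ∪ᵣ Ga.co) ∧
  acyclic (Ga.obs ∪ᵣ Ga.dob ∪ᵣ Ga.aob ∪ᵣ Ga.boba) ∧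
  (∀ a b, Ga.rmw a b → ¬ (Ga.fre ⬝ Ga.coe) a b)

/-! ## Compilation correspondence from IMM to ARMv8 -/

/-- compilation of an IMM label to an ARM label -/
def compileA : Label → ALabel
  | .read .acq x v _ => .read .q x v
  | .read _ x v _ => .read .rlx x v
  | .write .rel x v _ => .write .l x v
  | .write _ x v _ => .write .rlx x v
  | .fence .acq => .fence .ld
  | .fence _ => .fence .sy

/-- the event inserted just after `⟨i,n⟩`, namely `⟨i,n+0.5⟩` -/
def halfShift : Event → Event
  | .init x => .init x
  | .ev i n => .ev i (n + 1/2)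

/-- all serial numbers in `G` are whole numbers -/
def wholeSn (G : Execution) : Prop :=
  ∀ i : ℕ, ∀ n : ℚ, Event.ev i n ∈ G.E → ∃ m : ℕ, n = (m : ℚ)

/-- An ARM execution graph `Ga` corresponds to the IMM execution graph `G`
(Definition 4.4; the mapped program has the same reads-from and coherence order). -/
structure ArmCorr (G : Execution) (Ga : AExec) : Prop where
  /-- new events are added after strong exclusive writes -/
  events : Ga.E = G.E ∪ halfShift '' G.Wstrong
  lab_old : ∀ e ∈ G.E, Ga.lab e = compileA (G.lab e)
  lab_new : ∀ e ∈ Ga.E, e ∉ G.E → Ga.lab e = .fence .ld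
  rmw_eq : Ga.rmw = G.rmw
  data_eq : Ga.data = G.data
  addr_eq : Ga.addr = G.addr
  rf_eq : Ga.rf = G.rf
  co_eq : Ga.co = G.co
  /-- the compilation only adds control dependencies -/
  ctrl_mon : ∀ a b, G.ctrl a b → Ga.ctrl a b
  /-- exclusive reads entail a control dependency to any future event, except for
  their immediate exclusive write successor if it arose from an atomic increment -/
  ex_po : ∀ a b, a ∈ G.Rex → G.po a b → Ga.ctrl a b ∨ (Ga.rmw a b ∧ Ga.data a b)
  /-- CAS dependency entails a control dependency to any future event -/
  casdep_po : ∀ a b c, G.casdep a b → G.po b c → Ga.ctrl a c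

open Relation

/-! ## Order-theoretic preliminaries -/

theorem evLt_irrefl (a : Event) : ¬ evLt a a := by
  cases a <;> simp [evLt]

theorem evLt_trans {a b c : Event} (hab : evLt a b) (hbc : evLt b c) : evLt a c := by
  cases a <;> cases b <;> cases c <;> simp only [evLt] at hab hbc ⊢
  exact ⟨hab.1.trans hbc.1, hab.2.trans hbc.2⟩

theorem Execution.po_trans {G : Execution} {a b c : Event} (hab : G.po a b) (hbc : G.po b c) :
    G.po a c :=
  ⟨hab.1, hbc.2.1, evLt_trans hab.2.2 hbc.2.2⟩

theorem Execution.po_irrefl {G : Execution} {a : Event} : ¬ G.po a a :=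
  fun h => evLt_irrefl _ h.2.2

theorem AExec.po_trans {Ga : AExec} {a b c : Event} (hab : Ga.po a b) (hbc : Ga.po b c) :
    Ga.po a c :=
  ⟨hab.1, hbc.2.1, evLt_trans hab.2.2 hbc.2.2⟩

/-- If every edge of `r` either ends in `P` or increases the strict order `lt`, then every cycle
of `r` visits `P`. -/
theorem acyclic_of_no_cycle_at {r lt : REv} {P : Set Event}
    (lt_irrefl : ∀ a, ¬ lt a a) (lt_trans : ∀ a b c, lt a b → lt b c → lt a c)
    (step : ∀ a b, r a b → b ∈ P ∨ lt a b) (no_cycle : ∀ a ∈ P, ¬ TransGen r a a) :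
    acyclic r := by
  intro a ha
  have key : ∀ b, TransGen r a b →
      lt a b ∨ ∃ c ∈ P, TransGen r a c ∧ ReflTransGen r c b := by
    intro b hb
    induction hb with
    | single h =>
      rcases step _ _ h with hP | hlt
      · exact Or.inr ⟨_, hP, .single h, .refl⟩
      · exact Or.inl hlt
    | tail hab h ih =>
      rcases ih with ih | ⟨c, hc, hac, hcb⟩
      · rcases step _ _ h with hP | hlt
        · exact Or.inr ⟨_, hP, hab.tail h, .refl⟩
        · exact Or.inl (lt_trans _ _ _ ih hlt)
      · exact Or.inr ⟨c, hc, hac, hcb.tail h⟩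
  rcases key a ha with h | ⟨c, hc, hac, hca⟩
  · exact lt_irrefl a h
  · exact no_cycle c hc (TransGen.trans_right hca hac)

/-! ## ARM ordered-before, extended with fence nodes -/

namespace AExec

variable (Ga : AExec)

def Fence : Set Event := {e | e ∈ Ga.Fld ∨ e ∈ Ga.Fsy}

def ob : REv := Ga.obs ∪ᵣ Ga.dob ∪ᵣ Ga.aob ∪ᵣ Ga.boba

/-- `ob` together with the edges that enter and leave fences. -/
def fob : REv := fun a b =>
  Ga.ob a b ∨ Ga.po a b ∧ (b ∈ Ga.Fsy ∨ (a ∈ Ga.R ∧ b ∈ Ga.Fence) ∨ a ∈ Ga.Fence)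

variable {Ga}

theorem not_mem_fence_of_mem_R {e : Event} (h : e ∈ Ga.R) : e ∉ Ga.Fence := by
  obtain ⟨-, o, x, v, h⟩ := h
  rintro (⟨-, h'⟩ | ⟨-, h'⟩) <;> simp [h] at h'

theorem not_mem_fence_of_mem_W {e : Event} (h : e ∈ Ga.W) : e ∉ Ga.Fence := by
  obtain ⟨-, o, x, v, h⟩ := h
  rintro (⟨-, h'⟩ | ⟨-, h'⟩) <;> simp [h] at h'

theorem RQ_subset_R {e : Event} (h : e ∈ Ga.RQ) : e ∈ Ga.R :=
  ⟨h.1, _, h.2⟩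

theorem WL_subset_W {e : Event} (h : e ∈ Ga.WL) : e ∈ Ga.W :=
  ⟨h.1, _, h.2⟩

theorem ob_of_rfe {a b : Event} (h : Ga.rfe a b) : Ga.ob a b :=
  Or.inl (Or.inl (Or.inl (Or.inl (Or.inl h))))

theorem ob_of_fre {a b : Event} (h : Ga.fre a b) : Ga.ob a b :=
  Or.inl (Or.inl (Or.inl (Or.inl (Or.inr h))))

theorem ob_of_coe {a b : Event} (h : Ga.coe a b) : Ga.ob a b :=
  Or.inl (Or.inl (Or.inl (Or.inr h)))

theorem ob_of_dob {a b : Event} (h : Ga.dob a b) : Ga.ob a b :=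
  Or.inl (Or.inl (Or.inr h))

theorem ob_of_boba {a b : Event} (h : Ga.boba a b) : Ga.ob a b :=
  Or.inr h

theorem ob_of_Wex_rfi_RQ {a b : Event} (ha : a ∈ Ga.Wex) (h : Ga.rfi a b) (hb : b ∈ Ga.RQ) :
    Ga.ob a b :=
  Or.inl (Or.inr (Or.inr ⟨a, ⟨rfl, ha⟩, b, h, rfl, hb⟩))

theorem ob_of_data_rfi {a b c : Event} (h : Ga.data a b) (hbc : Ga.rfi b c) : Ga.ob a c :=
  ob_of_dob (Or.inl (Or.inl ⟨b, Or.inr h, Or.inr hbc⟩))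

theorem ob_of_data {a b : Event} (h : Ga.data a b) : Ga.ob a b :=
  ob_of_dob (Or.inl (Or.inl ⟨b, Or.inr h, Or.inl rfl⟩))

theorem ob_of_addr_rfi {a b c : Event} (h : Ga.addr a b) (hbc : Ga.rfi b c) : Ga.ob a c :=
  ob_of_dob (Or.inl (Or.inl ⟨b, Or.inl h, Or.inr hbc⟩))

theorem ob_of_addr {a b : Event} (h : Ga.addr a b) : Ga.ob a b :=
  ob_of_dob (Or.inl (Or.inl ⟨b, Or.inl h, Or.inl rfl⟩))

theorem ob_of_addr_po {a b c : Event} (h : Ga.addr a b) (hbc : Ga.po b c) (hc : c ∈ Ga.W) :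
    Ga.ob a c :=
  ob_of_dob (Or.inr ⟨b, h, c, hbc, rfl, hc⟩)

theorem ob_of_ctrl {a b : Event} (h : Ga.ctrl a b) (hb : b ∈ Ga.W) : Ga.ob a b :=
  ob_of_dob (Or.inl (Or.inr ⟨b, Or.inl h, b, ⟨rfl, hb⟩, Or.inl rfl⟩))

theorem ob_of_Fsy {a b c : Event} (hab : Ga.po a b) (hb : b ∈ Ga.Fsy) (hbc : Ga.po b c) :
    Ga.ob a c :=
  ob_of_boba (Or.inl (Or.inl (Or.inl ⟨b, hab, b, ⟨rfl, hb⟩, hbc⟩)))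

theorem ob_of_Fld {a b c : Event} (ha : a ∈ Ga.R) (hab : Ga.po a b) (hb : b ∈ Ga.Fld)
    (hbc : Ga.po b c) : Ga.ob a c :=
  ob_of_boba (Or.inl (Or.inl (Or.inr ⟨a, ⟨rfl, ha⟩, b, hab, b, ⟨rfl, hb⟩, hbc⟩)))

theorem ob_of_RQ {a b : Event} (ha : a ∈ Ga.RQ) (hab : Ga.po a b) : Ga.ob a b :=
  ob_of_boba (Or.inl (Or.inr ⟨a, ⟨rfl, ha⟩, hab⟩))

theorem ob_of_WL {a b c : Event} (hab : Ga.po a b) (hb : b ∈ Ga.WL) (hbc : rcl Ga.coi b c) :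
    Ga.ob a c :=
  ob_of_boba (Or.inr ⟨b, hab, b, ⟨rfl, hb⟩, hbc⟩)

theorem ob_of_read_fence {a b c : Event} (ha : a ∈ Ga.R) (hab : Ga.po a b) (hb : b ∈ Ga.Fence)
    (hbc : Ga.po b c) : Ga.ob a c := by
  rcases hb with hb | hb
  · exact ob_of_Fld ha hab hb hbc
  · exact ob_of_Fsy hab hb hbc

/-- An `ob` edge either joins two memory accesses or comes from a barrier. -/
theorem ob_cases (hwf : AExecWf Ga) {a b : Event} (h : Ga.ob a b) :
    (a ∉ Ga.Fence ∧ b ∉ Ga.Fence) ∨ Ga.boba a b := by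
  have hR : ∀ {e}, e ∈ Ga.R → e ∉ Ga.Fence := not_mem_fence_of_mem_R
  have hW : ∀ {e}, e ∈ Ga.W → e ∉ Ga.Fence := not_mem_fence_of_mem_W
  have hRW : ∀ {e}, (e ∈ Ga.R ∨ e ∈ Ga.W) → e ∉ Ga.Fence := fun h => h.elim hR hW
  rcases h with ((h | h) | h) | h
  · left
    rcases h with (h | h) | h
    · exact ⟨hW (hwf.rf_sub _ _ h.1).1, hR (hwf.rf_sub _ _ h.1).2.1⟩
    · obtain ⟨⟨c, hca, hcb⟩, -⟩ := h
      exact ⟨hR (hwf.rf_sub _ _ hca).2.1, hW (hwf.co_sub _ _ hcb).2.1⟩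
    · exact ⟨hW (hwf.co_sub _ _ h.1).1, hW (hwf.co_sub _ _ h.1).2.1⟩
  · left
    rcases h with (⟨c, hac, hcb⟩ | ⟨c, hac, d, ⟨rfl, hc⟩, hcb⟩) | ⟨c, hac, d, hcd, rfl, hd⟩
    · have ha : a ∈ Ga.R ∧ (c ∈ Ga.R ∨ c ∈ Ga.W) := by
        rcases hac with hac | hac
        · exact ⟨(hwf.addr_sub _ _ hac).1, (hwf.addr_sub _ _ hac).2.2⟩
        · exact ⟨(hwf.data_sub _ _ hac).1, Or.inr (hwf.data_sub _ _ hac).2.2⟩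
      refine ⟨hR ha.1, ?_⟩
      rcases hcb with rfl | hcb
      · exact hRW ha.2
      · exact hR (hwf.rf_sub _ _ hcb.1).2.1
    · have ha : a ∈ Ga.R := by
        rcases hac with hac | hac
        · exact (hwf.ctrl_sub _ _ hac).1
        · exact (hwf.data_sub _ _ hac).1
      refine ⟨hR ha, ?_⟩
      rcases hcb with rfl | hcb
      · exact hW hc
      · exact hW (hwf.co_sub _ _ hcb.1).2.1
    · exact ⟨hR (hwf.addr_sub _ _ hac).1, hW hd⟩
  · left
    rcases h with h | ⟨c, ⟨rfl, -⟩, d, hcd, rfl, hd⟩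
    · exact ⟨hR (hwf.rmw_sub _ _ h).1, hW (hwf.rmw_sub _ _ h).2.1⟩
    · exact ⟨hW (hwf.rf_sub _ _ hcd.1).1, hR (RQ_subset_R hd)⟩
  · exact Or.inr h

theorem boba_po {a b : Event} (h : Ga.boba a b) : Ga.po a b := by
  rcases h with ((⟨c, hac, d, ⟨rfl, -⟩, hcb⟩ | ⟨c, ⟨rfl, -⟩, d, hcd, e, ⟨rfl, -⟩, hdb⟩) |
    ⟨c, ⟨rfl, -⟩, hcb⟩) | ⟨c, hac, d, ⟨rfl, -⟩, hcb⟩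
  · exact po_trans hac hcb
  · exact po_trans hcd hdb
  · exact hcb
  · rcases hcb with rfl | hcb
    · exact hac
    · exact po_trans hac hcb.2

theorem ob_extend_of_fence (hwf : AExecWf Ga) {a b c : Event} (h : Ga.ob a b)
    (hb : b ∈ Ga.Fence) (hbc : Ga.po b c) : Ga.ob a c := by
  rcases ob_cases hwf h with ⟨-, h⟩ | h
  · exact absurd hb h
  rcases h with ((⟨d, had, e, ⟨rfl, hd⟩, hdb⟩ | ⟨d, ⟨rfl, ha⟩, e, hae, g, ⟨rfl, he⟩, heb⟩) |
    ⟨d, ⟨rfl, ha⟩, hab⟩) | ⟨d, had, e, ⟨rfl, hd⟩, hdb⟩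
  · exact ob_of_Fsy had hd (po_trans hdb hbc)
  · exact ob_of_Fld ha hae he (po_trans heb hbc)
  · exact ob_of_RQ ha (po_trans hab hbc)
  · refine absurd hb (not_mem_fence_of_mem_W ?_)
    rcases hdb with rfl | hdb
    · exact WL_subset_W hd
    · exact (hwf.co_sub _ _ hdb.1).2.1

theorem fob_po_of_fence (hwf : AExecWf Ga) {a b : Event} (h : Ga.fob a b)
    (hf : a ∈ Ga.Fence ∨ b ∈ Ga.Fence) : Ga.po a b := by
  rcases h with h | h
  · rcases ob_cases hwf h with ⟨ha, hb⟩ | h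
    · exact (hf.elim ha hb).elim
    · exact boba_po h
  · exact h.1

theorem fob_acyclic (hwf : AExecWf Ga) (hob : acyclic Ga.ob) : acyclic Ga.fob := by
  refine acyclic_of_no_cycle_at (lt := Ga.po) (P := Ga.Fenceᶜ)
    (fun a h => evLt_irrefl _ h.2.2) (fun a b c => po_trans) ?_ ?_
  · intro a b h
    by_cases hb : b ∈ Ga.Fence
    · exact Or.inr (fob_po_of_fence hwf h (Or.inr hb))
    · exact Or.inl hb
  · intro a ha hcyc
    have key : ∀ b, TransGen Ga.fob a b → TransGen Ga.ob a b ∨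
        (b ∈ Ga.Fence ∧ ∃ d, ReflTransGen Ga.ob a d ∧ ∀ c, Ga.po b c → Ga.ob d c) := by
      have enter : ∀ b c, ReflTransGen Ga.ob a b → Ga.fob b c →
          (b ∈ Ga.Fence → TransGen Ga.ob a b) → TransGen Ga.ob a c ∨
          (c ∈ Ga.Fence ∧ ∃ d, ReflTransGen Ga.ob a d ∧ ∀ z, Ga.po c z → Ga.ob d z) := by
        intro b c hab hbc hne
        rcases hbc with hbc | ⟨hbc, hc | ⟨hb, hc⟩ | hb⟩
        · exact Or.inl (TransGen.tail' hab hbc)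
        · exact Or.inr ⟨Or.inr hc, b, hab, fun z hz => ob_of_Fsy hbc hc hz⟩
        · exact Or.inr ⟨hc, b, hab, fun z hz => ob_of_read_fence hb hbc hc hz⟩
        · obtain ⟨d, had, hdb⟩ := TransGen.tail'_iff.1 (hne hb)
          exact Or.inl (TransGen.tail' had (ob_extend_of_fence hwf hdb hb hbc))
      intro b hb
      induction hb with
      | single h => exact enter _ _ .refl h (fun h' => absurd h' ha)
      | tail hab h ih =>
        rcases ih with ih | ⟨hF, d, had, hd⟩
        · exact enter _ _ ih.to_reflTransGen h (fun _ => ih)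
        · exact Or.inl (TransGen.tail' had (hd _ (fob_po_of_fence hwf h (Or.inl hF))))
    rcases key a hcyc with h | ⟨h, -⟩
    · exact hob a h
    · exact ha h

end AExec

/-! ## Transfer along the compilation correspondence -/

/-- A well-formed IMM graph with a corresponding consistent ARM graph. -/
structure ArmRefinement (G : Execution) (Ga : AExec) : Prop where
  wf : ExecWf G
  wfa : AExecWf Ga
  sn : wholeSn G
  corr : ArmCorr G Ga
  cons : ARMConsistent Ga

/-- Everything from `e` on, in program order, is `fob`-after `w`. -/
def Execution.Covers (G : Execution) (Ga : AExec) (w e : Event) : Prop :=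
  TransGen Ga.fob w e ∧ ∀ z, G.po e z → TransGen Ga.fob w z

theorem Execution.Covers.of_fob {G : Execution} {Ga : AExec} {s w e : Event}
    (hsw : TransGen Ga.fob s w) (h : G.Covers Ga w e) : G.Covers Ga s e :=
  ⟨hsw.trans h.1, fun z hz => hsw.trans (h.2 z hz)⟩

theorem Execution.Covers.po {G : Execution} {Ga : AExec} {w e e' : Event}
    (h : G.Covers Ga w e) (he : G.po e e') : G.Covers Ga w e' :=
  ⟨h.2 _ he, fun _ hz => h.2 _ (G.po_trans he hz)⟩

namespace ArmRefinement

variable {G : Execution} {Ga : AExec}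

theorem mem_E (S : ArmRefinement G Ga) {e : Event} (h : e ∈ G.E) : e ∈ Ga.E := by
  rw [S.corr.events]; exact Or.inl h

theorem po_of_po (S : ArmRefinement G Ga) {a b : Event} (h : G.po a b) : Ga.po a b :=
  ⟨S.mem_E h.1, S.mem_E h.2.1, h.2.2⟩

theorem R_eq (S : ArmRefinement G Ga) : Ga.R = G.R := by
  ext e
  constructor
  · rintro ⟨he, o, x, v, h⟩
    by_cases hG : e ∈ G.E
    · refine ⟨hG, ?_⟩
      rw [S.corr.lab_old e hG] at h
      unfold compileA at h
      split at h <;> simp_all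
    · simp [S.corr.lab_new e he hG] at h
  · rintro ⟨he, o, x, v, s, h⟩
    refine ⟨S.mem_E he, ?_⟩
    rw [S.corr.lab_old e he, h]
    cases o <;> simp [compileA]

theorem W_eq (S : ArmRefinement G Ga) : Ga.W = G.W := by
  ext e
  constructor
  · rintro ⟨he, o, x, v, h⟩
    by_cases hG : e ∈ G.E
    · refine ⟨hG, ?_⟩
      rw [S.corr.lab_old e hG] at h
      unfold compileA at h
      split at h <;> simp_all
    · simp [S.corr.lab_new e he hG] at h
  · rintro ⟨he, o, x, v, s, h⟩
    refine ⟨S.mem_E he, ?_⟩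
    rw [S.corr.lab_old e he, h]
    cases o <;> simp [compileA]

theorem Racq_RQ (S : ArmRefinement G Ga) {e : Event} (h : e ∈ G.Racq) : e ∈ Ga.RQ := by
  obtain ⟨he, x, v, s, h⟩ := h
  refine ⟨S.mem_E he, x, v, ?_⟩
  rw [S.corr.lab_old e he, h]; rfl

theorem Wrel_WL (S : ArmRefinement G Ga) {e : Event} (h : e ∈ G.Wrel) : e ∈ Ga.WL := by
  obtain ⟨he, x, v, s, h⟩ := h
  refine ⟨S.mem_E he, x, v, ?_⟩
  rw [S.corr.lab_old e he, h]; rfl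

theorem FgeRel_Fsy (S : ArmRefinement G Ga) {e : Event} (h : e ∈ G.FgeRel) : e ∈ Ga.Fsy := by
  obtain ⟨he, h⟩ := h
  refine ⟨S.mem_E he, ?_⟩
  rw [S.corr.lab_old e he]
  rcases h with h | h | h <;> rw [h] <;> rfl

theorem F_Fence (S : ArmRefinement G Ga) {e : Event} (h : e ∈ G.F) : e ∈ Ga.Fence := by
  obtain ⟨he, o, h⟩ := h
  have hl : Ga.lab e = compileA (.fence o) := by rw [S.corr.lab_old e he, h]
  have hE := S.mem_E he
  cases o
  case acq => exact Or.inl ⟨hE, hl⟩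
  all_goals exact Or.inr ⟨hE, hl⟩

theorem Fsc_Fsy (S : ArmRefinement G Ga) {e : Event} (h : e ∈ G.Fsc) : e ∈ Ga.Fsy :=
  S.FgeRel_Fsy ⟨h.1, Or.inr (Or.inr h.2)⟩

theorem FgeAcq_Fence (S : ArmRefinement G Ga) {e : Event} (h : e ∈ G.FgeAcq) : e ∈ Ga.Fence :=
  S.F_Fence ⟨h.1, by rcases h.2 with h | h | h <;> exact ⟨_, h⟩⟩

theorem loc_eq (S : ArmRefinement G Ga) {e : Event} (he : e ∈ G.E) : Ga.loc e = G.loc e := by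
  unfold AExec.loc Execution.loc
  rw [S.corr.lab_old e he]
  rcases G.lab e with ⟨o, x, v, s⟩ | ⟨o, x, v, s⟩ | o <;> cases o <;> rfl

theorem sameLoc_of_sameLoc (S : ArmRefinement G Ga)
    {a b : Event} (ha : a ∈ G.E) (hb : b ∈ G.E) (h : G.sameLoc a b) :
    Ga.sameLoc a b := by
  obtain ⟨x, hxa, hxb⟩ := h
  exact ⟨x, (S.loc_eq ha).trans hxa, (S.loc_eq hb).trans hxb⟩

theorem rfe_of_not_po (S : ArmRefinement G Ga)
    {a b : Event} (h : G.rf a b) (hn : ¬ G.po a b) : Ga.rfe a b :=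
  ⟨S.corr.rf_eq ▸ h, fun hp => hn ⟨(S.wf.rf_sub _ _ h).1.1, (S.wf.rf_sub _ _ h).2.1.1, hp.2.2⟩⟩

theorem coe_of_not_po (S : ArmRefinement G Ga)
    {a b : Event} (h : G.co a b) (hn : ¬ G.po a b) : Ga.coe a b :=
  ⟨S.corr.co_eq ▸ h, fun hp => hn ⟨(S.wf.co_sub _ _ h).1.1, (S.wf.co_sub _ _ h).2.1.1, hp.2.2⟩⟩

theorem fr_of_fr (S : ArmRefinement G Ga) {a b : Event} (h : G.fr a b) : Ga.fr a b := by
  unfold AExec.fr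
  rw [S.corr.rf_eq, S.corr.co_eq]
  exact h

theorem fre_of_not_po (S : ArmRefinement G Ga)
    {a b : Event} (h : G.fr a b) (hn : ¬ G.po a b) : Ga.fre a b := by
  refine ⟨S.fr_of_fr h, fun hp => hn ?_⟩
  obtain ⟨c, hca, hcb⟩ := h
  exact ⟨(S.wf.rf_sub _ _ hca).2.1.1, (S.wf.co_sub _ _ hcb).2.1.1, hp.2.2⟩

theorem rfi_of_po (S : ArmRefinement G Ga)
    {a b : Event} (h : G.rf a b) (hp : G.po a b) : Ga.rfi a b :=
  ⟨S.corr.rf_eq ▸ h, S.po_of_po hp⟩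

theorem coi_of_coi (S : ArmRefinement G Ga) {a b : Event} (h : G.coi a b) : Ga.coi a b :=
  ⟨S.corr.co_eq ▸ h.1, S.po_of_po h.2⟩

theorem rcl_coi_of_coi (S : ArmRefinement G Ga)
    {a b : Event} (h : rcl G.coi a b) : rcl Ga.coi a b :=
  h.imp id S.coi_of_coi

theorem fob_of_rfe (S : ArmRefinement G Ga)
    {a b : Event} (h : G.rf a b) (hn : ¬ G.po a b) : TransGen Ga.fob a b :=
  .single (Or.inl (AExec.ob_of_rfe (S.rfe_of_not_po h hn)))

theorem fob_of_fence_po (S : ArmRefinement G Ga)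
    {a b : Event} (ha : a ∈ Ga.Fence) (h : G.po a b) : TransGen Ga.fob a b :=
  .single (Or.inr ⟨S.po_of_po h, Or.inr (Or.inr ha)⟩)

theorem fob_of_read_po_fence (S : ArmRefinement G Ga)
    {a b : Event} (ha : a ∈ G.R) (hb : b ∈ Ga.Fence) (h : G.po a b) :
    TransGen Ga.fob a b :=
  .single (Or.inr ⟨S.po_of_po h, Or.inr (Or.inl ⟨S.R_eq ▸ ha, hb⟩)⟩)

theorem fob_of_po_Fsy (S : ArmRefinement G Ga)
    {a b : Event} (hb : b ∈ Ga.Fsy) (h : G.po a b) : TransGen Ga.fob a b :=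
  .single (Or.inr ⟨S.po_of_po h, Or.inl hb⟩)

theorem fob_irrefl (S : ArmRefinement G Ga) {a : Event} : ¬ TransGen Ga.fob a a :=
  AExec.fob_acyclic S.wfa S.cons.2.2.2.1 a

theorem not_rf_W (S : ArmRefinement G Ga) {a b : Event} (h : G.rf a b) (hb : b ∈ G.W) : False := by
  obtain ⟨-, o, x, v, s, h1⟩ := (S.wf.rf_sub _ _ h).2.1
  obtain ⟨-, o', x', v', s', h2⟩ := hb
  simp [h1] at h2

theorem disjoint_RW {e : Event} (hR : e ∈ G.R) (hW : e ∈ G.W) : False := by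
  obtain ⟨-, o, x, v, s, h1⟩ := hR
  obtain ⟨-, o', x', v', s', h2⟩ := hW
  simp [h1] at h2

/-! ### Coherence per location -/

theorem sc_per_loc (S : ArmRefinement G Ga) {a b : Event} (hab : G.poloc a b)
    (hba : TransGen (G.rf ∪ᵣ G.fr ∪ᵣ G.co) b a) : False := by
  refine S.cons.2.2.1 a (TransGen.head ?_ (TransGen.mono ?_ _ _ hba))
  · exact Or.inl (Or.inl (Or.inl
      ⟨S.po_of_po hab.1, S.sameLoc_of_sameLoc hab.1.1 hab.1.2.1 hab.2⟩))
  · rintro c d ((h | h) | h)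
    · exact Or.inl (Or.inl (Or.inr (S.corr.rf_eq ▸ h)))
    · exact Or.inl (Or.inr (S.fr_of_fr h))
    · exact Or.inr (S.corr.co_eq ▸ h)

theorem co_total (S : ArmRefinement G Ga) (x : Loc) : totalOn (G.Wloc x) G.co := by
  intro a ha b hb hne
  have hW : ∀ {e}, e ∈ G.Wloc x → e ∈ Ga.Wloc x := fun h =>
    ⟨S.W_eq ▸ h.1, (S.loc_eq h.1.1).trans h.2⟩
  have := S.cons.2.1 x a (hW ha) b (hW hb) hne
  rwa [S.corr.co_eq] at this

theorem coi_of_poloc (S : ArmRefinement G Ga)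
    {a b : Event} (ha : a ∈ G.W) (hb : b ∈ G.W) (h : G.po a b)
    (hl : G.sameLoc a b) : G.coi a b := by
  obtain ⟨x, hxa, hxb⟩ := hl
  have hne : a ≠ b := by
    rintro rfl
    exact G.po_irrefl h
  rcases S.co_total x a ⟨ha, hxa⟩ b ⟨hb, hxb⟩ hne with hab | hba
  · exact ⟨hab, h⟩
  · exact (S.sc_per_loc ⟨h, x, hxa, hxb⟩ (.single (Or.inr hba))).elim

theorem sameLoc_symm {a b : Event} (h : G.sameLoc a b) : G.sameLoc b a :=
  ⟨h.choose, h.choose_spec.2, h.choose_spec.1⟩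

theorem sameLoc_trans {a b c : Event} (hab : G.sameLoc a b) (hbc : G.sameLoc b c) :
    G.sameLoc a c := by
  obtain ⟨x, hxa, hxb⟩ := hab
  obtain ⟨y, hyb, hyc⟩ := hbc
  obtain rfl : x = y := Option.some_injective _ (hxb.symm.trans hyb)
  exact ⟨x, hxa, hyc⟩

theorem sameLoc_of_fr (S : ArmRefinement G Ga) {a b : Event} (h : G.fr a b) : G.sameLoc a b := by
  obtain ⟨c, hca, hcb⟩ := h
  exact sameLoc_trans (sameLoc_symm (S.wf.rf_sub _ _ hca).2.2) (S.wf.co_sub _ _ hcb).2.2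

/-! ### Release sequences, synchronization and happens-before -/

theorem rmw_po (S : ArmRefinement G Ga) {a b : Event} (h : G.rmw a b) : G.po a b :=
  (S.wf.rmw_sub _ _ h).2.2.2.1

theorem Rex_subset_R {e : Event} (h : e ∈ G.Rex) : e ∈ G.R := by
  obtain ⟨he, o, x, v, h⟩ := h
  exact ⟨he, o, x, v, _, h⟩

theorem fob_of_Rex_po_W (S : ArmRefinement G Ga)
    {a b : Event} (ha : a ∈ G.Rex) (hab : G.po a b) (hb : b ∈ G.W) :
    TransGen Ga.fob a b := by
  refine .single (Or.inl ?_)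
  rcases S.corr.ex_po a b ha hab with h | h
  · exact AExec.ob_of_ctrl h (S.W_eq ▸ hb)
  · exact AExec.ob_of_data h.2

/-- A prefix of a release sequence from `w` to `w'` either stays within one thread, or leaves it
at a write `v` that is `fob`-before an exclusive read preceding `w'` in program order. -/
def RelSeqReach (G : Execution) (Ga : AExec) (w w' : Event) : Prop :=
  (w = w' ∨ G.po w w' ∧ G.sameLoc w w') ∨
    ∃ v, rcl G.coi w v ∧ ∃ r ∈ G.Rex, TransGen Ga.fob v r ∧ G.po r w' ∧ w' ∈ Ga.Wex

theorem relSeqReach_of_rs (S : ArmRefinement G Ga) {w w' : Event} (h : G.rs w w') :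
    w ∈ G.W ∧ RelSeqReach G Ga w w' := by
  rcases h with ⟨a, ⟨rfl, hw⟩, b, hab, rfl, hb⟩ | ⟨a, ⟨rfl, hw⟩, h⟩
  · exact ⟨hw, Or.inl (Or.inr hab)⟩
  refine ⟨hw, ?_⟩
  change ReflTransGen _ _ _ at h
  induction h with
  | refl => exact Or.inl (Or.inl rfl)
  | @tail b c _ hbc ih =>
    obtain ⟨u, hbu, r, hur, hrc⟩ := hbc
    have hu : u ∈ G.W := (S.wf.rf_sub _ _ hur).1
    have hr : r ∈ G.Rex := (S.wf.rmw_sub _ _ hrc).1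
    have hc : c ∈ Ga.Wex := ⟨r, S.corr.rmw_eq ▸ hrc⟩
    have hlc : G.sameLoc u c :=
      sameLoc_trans (S.wf.rf_sub _ _ hur).2.2 (S.wf.rmw_sub _ _ hrc).2.2.1
    have hrcp := S.rmw_po hrc
    rcases ih with ih | ⟨v, hwv, r', hr', hvr', hr'b, -⟩
    · have hwu : w = u ∨ G.po w u ∧ G.sameLoc w u := by
        rcases ih with rfl | ih <;> rcases hbu with rfl | hbu
        · exact Or.inl rfl
        · exact Or.inr hbu
        · exact Or.inr ih
        · exact Or.inr ⟨G.po_trans ih.1 hbu.1, sameLoc_trans ih.2 hbu.2⟩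
      by_cases hp : G.po u r
      · left; right
        rcases hwu with rfl | hwu
        · exact ⟨G.po_trans hp hrcp, hlc⟩
        · exact ⟨G.po_trans hwu.1 (G.po_trans hp hrcp), sameLoc_trans hwu.2 hlc⟩
      · exact Or.inr ⟨u, hwu.imp id fun h => S.coi_of_poloc hw hu h.1 h.2, r, hr,
          S.fob_of_rfe hur hp, hrcp, hc⟩
    · have hr'u : G.po r' u := by
        rcases hbu with rfl | hbu
        · exact hr'b
        · exact G.po_trans hr'b hbu.1
      by_cases hp : G.po u r
      · exact Or.inr ⟨v, hwv, r', hr', hvr', G.po_trans hr'u (G.po_trans hp hrcp), hc⟩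
      · exact Or.inr ⟨v, hwv, r, hr,
          hvr'.trans ((S.fob_of_Rex_po_W hr' hr'u hu).trans (S.fob_of_rfe hur hp)), hrcp, hc⟩

/-- Reading from a release sequence headed by `w`. -/
theorem rs_rf (S : ArmRefinement G Ga) {w w' r : Event} (hrs : G.rs w w')
    (hrf : (G.rfi ∪ᵣ rcl G.poloc ⬝ G.rfe) w' r) :
    G.po w r ∨ ∃ v, rcl G.coi w v ∧ (r ∈ G.Racq → TransGen Ga.fob v r) ∧
      ∃ q ∈ G.R, TransGen Ga.fob v q ∧ (q = r ∨ G.po q r) := by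
  obtain ⟨hw, hpre⟩ := S.relSeqReach_of_rs hrs
  rcases hrf with hrf | ⟨u, hu, hrf⟩
  · have hw' : w' ∈ G.W := (S.wf.rf_sub _ _ hrf.1).1
    rcases hpre with (rfl | h) | ⟨v, hwv, q, hq, hvq, hqw, hex⟩
    · exact Or.inl hrf.2
    · exact Or.inl (G.po_trans h.1 hrf.2)
    · refine Or.inr ⟨v, hwv, fun hr => ?_, q, Rex_subset_R hq, hvq,
        Or.inr (G.po_trans hqw hrf.2)⟩
      exact (hvq.trans (S.fob_of_Rex_po_W hq hqw hw')).tail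
        (Or.inl (AExec.ob_of_Wex_rfi_RQ hex (S.rfi_of_po hrf.1 hrf.2) (S.Racq_RQ hr)))
  · have huW : u ∈ G.W := (S.wf.rf_sub _ _ hrf.1).1
    have hr : r ∈ G.R := (S.wf.rf_sub _ _ hrf.1).2.1
    have hur := S.fob_of_rfe hrf.1 hrf.2
    rcases hpre with hpre | ⟨v, hwv, q, hq, hvq, hqw, hex⟩
    · have hwu : rcl G.coi w u := by
        rcases hpre with rfl | h <;> rcases hu with rfl | hu
        · exact Or.inl rfl
        · exact Or.inr (S.coi_of_poloc hw huW hu.1 hu.2)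
        · exact Or.inr (S.coi_of_poloc hw huW h.1 h.2)
        · exact Or.inr (S.coi_of_poloc hw huW (G.po_trans h.1 hu.1) (sameLoc_trans h.2 hu.2))
      exact Or.inr ⟨u, hwu, fun _ => hur, r, hr, hur, Or.inl rfl⟩
    · have hqu : G.po q u := by
        rcases hu with rfl | hu
        · exact hqw
        · exact G.po_trans hqw hu.1
      have hvr := hvq.trans ((S.fob_of_Rex_po_W hq hqu huW).trans hur)
      exact Or.inr ⟨v, hwv, fun _ => hvr, r, hr, hvr, Or.inl rfl⟩

theorem sw_cases (S : ArmRefinement G Ga) {a b : Event} (h : G.sw a b) :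
    ∃ w ∈ G.W, (a = w ∧ a ∈ G.Wrel ∨ a ∈ G.FgeRel ∧ G.po a w) ∧
      (G.po w b ∨ ∃ v, rcl G.coi w v ∧ G.Covers Ga v b) := by
  obtain ⟨w', ⟨w, haw, hrs⟩, r, hrf, hb⟩ := h
  refine ⟨w, (S.relSeqReach_of_rs hrs).1, ?_, ?_⟩
  · rcases haw with haw | ⟨c, ⟨rfl, ha⟩, haw⟩
    · exact Or.inl haw
    · exact Or.inr ⟨ha, haw⟩
  rcases S.rs_rf hrs hrf with hwr | ⟨v, hwv, hacq, q, hq, hvq, hqr⟩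
  · left
    rcases hb with ⟨rfl, -⟩ | ⟨c, hrc, rfl, -⟩
    · exact hwr
    · exact G.po_trans hwr hrc
  · refine Or.inr ⟨v, hwv, ?_⟩
    rcases hb with ⟨rfl, hr⟩ | ⟨c, hrc, rfl, hc⟩
    · exact ⟨hacq hr, fun z hz =>
        (hacq hr).tail (Or.inl (AExec.ob_of_RQ (S.Racq_RQ hr) (S.po_of_po hz)))⟩
    · have hF := S.FgeAcq_Fence hc
      have hqc : G.po q c := by
        rcases hqr with rfl | hqr
        · exact hrc
        · exact G.po_trans hqr hrc
      have hvc := hvq.trans (S.fob_of_read_po_fence hq hF hqc)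
      exact ⟨hvc, fun z hz => hvc.trans (S.fob_of_fence_po hF hz)⟩

theorem po_of_po_rcl_coi {a b c : Event} (hab : G.po a b) (hbc : rcl G.coi b c) : G.po a c := by
  rcases hbc with rfl | hbc
  · exact hab
  · exact G.po_trans hab hbc.2

theorem hb_cases (S : ArmRefinement G Ga) {a b : Event} (h : G.hb a b) :
    G.po a b ∨ ∃ w, rcl G.coi a w ∧ G.Covers Ga w b := by
  change TransGen _ _ _ at h
  induction h with
  | single h =>
    rcases h with h | h
    · exact Or.inl h
    obtain ⟨w, -, ⟨rfl, -⟩ | ⟨ha, haw⟩, hwb⟩ := S.sw_cases h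
    · exact hwb
    · rcases hwb with hwb | ⟨v, hwv, hvb⟩
      · exact Or.inl (G.po_trans haw hwb)
      · exact Or.inr ⟨a, Or.inl rfl, hvb.of_fob
          (S.fob_of_fence_po (Or.inr (S.FgeRel_Fsy ha)) (po_of_po_rcl_coi haw hwv))⟩
  | @tail b c _ h ih =>
    rcases h with h | h
    · rcases ih with ih | ⟨w, haw, hwb⟩
      · exact Or.inl (G.po_trans ih h)
      · exact Or.inr ⟨w, haw, hwb.po h⟩
    obtain ⟨u, -, hbu, huc⟩ := S.sw_cases h
    rcases ih with ih | ⟨w, haw, hwb⟩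
    · have hau : G.po a u := by
        rcases hbu with ⟨rfl, -⟩ | ⟨-, hbu⟩
        · exact ih
        · exact G.po_trans ih hbu
      rcases huc with huc | ⟨v, huv, hvc⟩
      · exact Or.inl (G.po_trans hau huc)
      · refine Or.inr ⟨a, Or.inl rfl, hvc.of_fob (.single (Or.inl ?_))⟩
        rcases hbu with ⟨rfl, hb⟩ | ⟨hb, hbu⟩
        · exact AExec.ob_of_WL (S.po_of_po ih) (S.Wrel_WL hb) (S.rcl_coi_of_coi huv)
        · exact AExec.ob_of_Fsy (S.po_of_po ih) (S.FgeRel_Fsy hb)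
            (S.po_of_po (po_of_po_rcl_coi hbu huv))
    · refine Or.inr ⟨w, haw, ?_⟩
      rcases huc with huc | ⟨v, huv, hvc⟩
      · rcases hbu with ⟨rfl, -⟩ | ⟨-, hbu⟩
        · exact hwb.po huc
        · exact hwb.po (G.po_trans hbu huc)
      · refine hvc.of_fob ?_
        rcases hbu with ⟨rfl, -⟩ | ⟨-, hbu⟩
        · rcases huv with rfl | huv
          · exact hwb.1
          · exact hwb.2 _ huv.2
        · exact hwb.2 _ (po_of_po_rcl_coi hbu huv)

/-! ### Coherence -/

/-- One step of communication. -/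
def comm (G : Execution) : REv := fun a b => G.rf a b ∨ G.fr a b ∨ G.co a b

theorem comm_of_coi (S : ArmRefinement G Ga)
    {a b c : Event} (hab : comm G a b) (hbc : G.coi b c) : comm G a c := by
  rcases hab with hab | ⟨d, hda, hdb⟩ | hab
  · exact (S.not_rf_W hab (S.wf.co_sub _ _ hbc.1).1).elim
  · exact Or.inr (Or.inl ⟨d, hda, S.wf.co_trans hdb hbc.1⟩)
  · exact Or.inr (Or.inr (S.wf.co_trans hab hbc.1))

theorem comm_of_rcl_coi (S : ArmRefinement G Ga)
    {a b c : Event} (hab : comm G a b) (hbc : rcl G.coi b c) :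
    comm G a c := by
  rcases hbc with rfl | hbc
  · exact hab
  · exact S.comm_of_coi hab hbc

theorem sameLoc_of_comm (S : ArmRefinement G Ga)
    {a b : Event} (h : comm G a b) : G.sameLoc a b := by
  rcases h with h | h | h
  · exact (S.wf.rf_sub _ _ h).2.2
  · exact S.sameLoc_of_fr h
  · exact (S.wf.co_sub _ _ h).2.2

theorem comm_le {a b : Event} (h : comm G a b) : (G.rf ∪ᵣ G.fr ∪ᵣ G.co) a b := by
  rcases h with h | h | h
  · exact Or.inl (Or.inl h)
  · exact Or.inl (Or.inr h)
  · exact Or.inr h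

theorem fob_of_covers_comm (S : ArmRefinement G Ga)
    {w a b : Event} (h : G.Covers Ga w a) (hab : comm G a b) :
    TransGen Ga.fob w b := by
  by_cases hp : G.po a b
  · exact h.2 _ hp
  refine h.1.tail (Or.inl ?_)
  rcases hab with hab | hab | hab
  · exact AExec.ob_of_rfe (S.rfe_of_not_po hab hp)
  · exact AExec.ob_of_fre (S.fre_of_not_po hab hp)
  · exact AExec.ob_of_coe (S.coe_of_not_po hab hp)

/-- `eco` is a single communication step, possibly followed by a read of the reached write. -/
theorem eco_cases {a b : Event} (h : G.eco a b) :
    comm G a b ∨ ∃ w, comm G a w ∧ G.rf w b := by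
  rcases h with (h | ⟨w, haw, rfl | hwb⟩) | ⟨w, haw, rfl | hwb⟩
  · exact Or.inl (Or.inl h)
  · exact Or.inl (Or.inr (Or.inr haw))
  · exact Or.inr ⟨w, Or.inr (Or.inr haw), hwb⟩
  · exact Or.inl (Or.inr (Or.inl haw))
  · exact Or.inr ⟨w, Or.inr (Or.inl haw), hwb⟩

theorem rcl_coi_of_R (S : ArmRefinement G Ga)
    {a b : Event} (ha : a ∈ G.R) (h : rcl G.coi a b) : a = b :=
  h.resolve_right fun h => disjoint_RW ha (S.wf.co_sub _ _ h.1).1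

theorem hb_comm_irrefl (S : ArmRefinement G Ga)
    {a b : Event} (hab : G.hb a b) (hba : comm G b a) : False := by
  rcases S.hb_cases hab with hp | ⟨w, haw, hwb⟩
  · exact S.sc_per_loc ⟨hp, sameLoc_symm (S.sameLoc_of_comm hba)⟩ (.single (comm_le hba))
  · exact S.fob_irrefl (S.fob_of_covers_comm hwb (S.comm_of_rcl_coi hba haw))

theorem coherence (S : ArmRefinement G Ga) : Irreflexive (G.hb ⬝ rcl G.eco) := by
  rintro a ⟨b, hab, rfl | hba⟩
  · rcases S.hb_cases hab with hp | ⟨w, rfl | hbw, hwb⟩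
    · exact G.po_irrefl hp
    · exact S.fob_irrefl hwb.1
    · exact S.fob_irrefl (hwb.2 _ hbw.2)
  rcases eco_cases hba with hba | ⟨w, hbw, hwa⟩
  · exact S.hb_comm_irrefl hab hba
  by_cases hp : G.po w a
  · exact S.hb_comm_irrefl (TransGen.head (Or.inl hp) hab) hbw
  have ha : a ∈ G.R := (S.wf.rf_sub _ _ hwa).2.1
  rcases S.hb_cases hab with hp' | ⟨u, hau, hub⟩
  · refine S.sc_per_loc ⟨hp', sameLoc_symm (sameLoc_trans (S.sameLoc_of_comm hbw)
      (S.wf.rf_sub _ _ hwa).2.2)⟩ ((TransGen.single (comm_le hbw)).tail (Or.inl (Or.inl hwa)))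
  · obtain rfl := S.rcl_coi_of_R ha hau
    exact S.fob_irrefl ((S.fob_of_covers_comm hub hbw).trans (S.fob_of_rfe hwa hp))

/-! ### No thin air -/

theorem fob_of_hb_Fsc (S : ArmRefinement G Ga) {w a f : Event} (haf : G.hb a f) (hf : f ∈ G.Fsc)
    (hw : ∀ v, rcl G.coi a v → TransGen Ga.fob w v) : TransGen Ga.fob w f := by
  rcases S.hb_cases haf with hp | ⟨v, hav, hvf⟩
  · exact (hw a (Or.inl rfl)).trans (S.fob_of_po_Fsy (S.Fsc_Fsy hf) hp)
  · exact (hw v hav).trans hvf.1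

theorem fob_of_psc (S : ArmRefinement G Ga)
    {a b : Event} (h : G.psc a b) : TransGen Ga.fob a b := by
  obtain ⟨c, ⟨rfl, ha⟩, x, hax, y, hxy, d, hyb, rfl, hb⟩ := h
  have hF : a ∈ Ga.Fence := Or.inr (S.Fsc_Fsy ha)
  have hcov : G.Covers Ga a x := by
    rcases S.hb_cases hax with hp | ⟨w, rfl | haw, hwx⟩
    · exact ⟨S.fob_of_fence_po hF hp, fun z hz => S.fob_of_fence_po hF (G.po_trans hp hz)⟩
    · exact hwx
    · exact (AExec.not_mem_fence_of_mem_W (S.W_eq ▸ (S.wf.co_sub _ _ haw.1).1) hF).elim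
  rcases eco_cases hxy with hxy | ⟨w, hxw, hwy⟩
  · exact S.fob_of_hb_Fsc hyb hb fun v hv =>
      S.fob_of_covers_comm hcov (S.comm_of_rcl_coi hxy hv)
  by_cases hp : G.po w y
  · exact S.fob_of_hb_Fsc (TransGen.head (Or.inl hp) hyb) hb fun v hv =>
      S.fob_of_covers_comm hcov (S.comm_of_rcl_coi hxw hv)
  · refine S.fob_of_hb_Fsc hyb hb fun v hv => ?_
    obtain rfl := S.rcl_coi_of_R (S.wf.rf_sub _ _ hwy).2.1 hv
    exact (S.fob_of_covers_comm hcov hxw).trans (S.fob_of_rfe hwy hp)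

theorem deps_po (S : ArmRefinement G Ga) {a b : Event} (h : (G.deps ∪ᵣ G.rfi) a b) : G.po a b := by
  rcases h with ((((h | h) | ⟨c, hac, hcb⟩) | h) | ⟨c, ⟨rfl, -⟩, h⟩) | h
  · exact (S.wf.data_sub _ _ h).2.1
  · exact (S.wf.ctrl_sub _ _ h).2
  · rcases hcb with rfl | hcb
    · exact (S.wf.addr_sub _ _ hac).2.1
    · exact G.po_trans (S.wf.addr_sub _ _ hac).2.1 hcb
  · exact (S.wf.casdep_sub _ _ h).2.1
  · exact h
  · exact h.2

theorem deps_tcl_po (S : ArmRefinement G Ga)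
    {a b : Event} (h : TransGen (G.deps ∪ᵣ G.rfi) a b) : G.po a b := by
  induction h with
  | single h => exact S.deps_po h
  | tail _ h ih => exact G.po_trans ih (S.deps_po h)

theorem deps_source_R (S : ArmRefinement G Ga) {a b : Event} (h : G.deps a b) : a ∈ G.R := by
  rcases h with (((h | h) | ⟨c, hac, hcb⟩) | h) | ⟨c, ⟨rfl, h'⟩, h⟩
  · exact (S.wf.data_sub _ _ h).1
  · exact (S.wf.ctrl_sub _ _ h).1
  · exact (S.wf.addr_sub _ _ hac).1
  · exact (S.wf.casdep_sub _ _ h).1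
  · exact Rex_subset_R h'

theorem ob_of_deps_W (S : ArmRefinement G Ga)
    {a b : Event} (h : G.deps a b) (hb : b ∈ G.W) : Ga.ob a b := by
  have hb' : b ∈ Ga.W := S.W_eq ▸ hb
  rcases h with (((h | h) | ⟨c, hac, hcb⟩) | h) | ⟨c, ⟨rfl, ha⟩, h⟩
  · exact AExec.ob_of_data (S.corr.data_eq ▸ h)
  · exact AExec.ob_of_ctrl (S.corr.ctrl_mon _ _ h) hb'
  · rcases hcb with rfl | hcb
    · exact AExec.ob_of_addr (S.corr.addr_eq ▸ hac)
    · exact AExec.ob_of_addr_po (S.corr.addr_eq ▸ hac) (S.po_of_po hcb) hb'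
  · exact (disjoint_RW (Rex_subset_R (S.wf.casdep_sub _ _ h).2.2) hb).elim
  · rcases S.corr.ex_po a b ha h with h | h
    · exact AExec.ob_of_ctrl h hb'
    · exact AExec.ob_of_data h.2

/-- A dependency continued in program order to a write `w` orders its source before `w`, unless
it is a data or address dependency. -/
theorem ob_of_deps_po_W (S : ArmRefinement G Ga)
    {a b w : Event} (h : G.deps a b) (hbw : G.po b w) (hw : w ∈ G.W) :
    Ga.ob a w ∨ Ga.data a b ∨ Ga.addr a b := by
  have hw' : w ∈ Ga.W := S.W_eq ▸ hw
  rcases h with (((h | h) | ⟨c, hac, hcb⟩) | h) | ⟨c, ⟨rfl, ha⟩, h⟩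
  · exact Or.inr (Or.inl (S.corr.data_eq ▸ h))
  · exact Or.inl (AExec.ob_of_ctrl (S.corr.ctrl_mon _ _ (S.wf.ctrl_po _ _ _ h hbw)) hw')
  · rcases hcb with rfl | hcb
    · exact Or.inr (Or.inr (S.corr.addr_eq ▸ hac))
    · exact Or.inl (AExec.ob_of_addr_po (S.corr.addr_eq ▸ hac)
        (S.po_of_po (G.po_trans hcb hbw)) hw')
  · exact Or.inl (AExec.ob_of_ctrl (S.corr.casdep_po _ _ _ h hbw) hw')
  · rcases S.corr.ex_po a b ha h with h | h
    · exact Or.inl (AExec.ob_of_ctrl (S.wfa.ctrl_po _ _ _ h (S.po_of_po hbw)) hw')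
    · exact Or.inr (Or.inl h.2)

theorem ob_of_deps_tcl (S : ArmRefinement G Ga)
    {a w : Event} (h : TransGen (G.deps ∪ᵣ G.rfi) a w) (hw : w ∈ G.W) :
    (a ∈ G.R → TransGen Ga.ob a w) ∧
      (a ∈ G.W → ∃ r, Ga.rfi a r ∧ TransGen Ga.ob r w) := by
  induction h using TransGen.head_induction_on with
  | @single a h =>
    rcases h with h | h
    · exact ⟨fun _ => .single (S.ob_of_deps_W h hw),
        fun ha => (disjoint_RW (S.deps_source_R h) ha).elim⟩
    · exact (S.not_rf_W h.1 hw).elim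
  | @head a b h hbw ih =>
    rcases h with h | h
    · refine ⟨fun _ => ?_, fun ha => (disjoint_RW (S.deps_source_R h) ha).elim⟩
      rcases S.ob_of_deps_po_W h (S.deps_tcl_po hbw) hw with h | h | h
      · exact .single h
      · obtain ⟨r, hbr, hrw⟩ := ih.2 (S.W_eq ▸ (S.wfa.data_sub _ _ h).2.2)
        exact hrw.head (AExec.ob_of_data_rfi h hbr)
      · rcases (S.wfa.addr_sub _ _ h).2.2 with hb | hb
        · exact (ih.1 (S.R_eq ▸ hb)).head (AExec.ob_of_addr h)
        · obtain ⟨r, hbr, hrw⟩ := ih.2 (S.W_eq ▸ hb)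
          exact hrw.head (AExec.ob_of_addr_rfi h hbr)
    · have hrf := S.wf.rf_sub _ _ h.1
      exact ⟨fun ha => (disjoint_RW ha hrf.1).elim,
        fun _ => ⟨b, S.rfi_of_po h.1 h.2, ih.1 hrf.2.1⟩⟩

theorem fob_of_ppo (S : ArmRefinement G Ga)
    {a b : Event} (h : G.ppo a b) : TransGen Ga.fob a b := by
  obtain ⟨c, ⟨rfl, ha⟩, d, h, rfl, hb⟩ := h
  exact TransGen.mono (fun _ _ => Or.inl) _ _ ((S.ob_of_deps_tcl h hb).1 ha)

theorem ppo_po (S : ArmRefinement G Ga) {a b : Event} (h : G.ppo a b) : G.po a b := by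
  obtain ⟨c, ⟨rfl, ha⟩, d, h, rfl, hb⟩ := h
  exact S.deps_tcl_po h

/-- The load fence inserted after a strong write precedes all later events of the thread. -/
theorem strong_fence (S : ArmRefinement G Ga) {w e : Event} (hw : w ∈ G.Wstrong) (hwe : G.po w e) :
    halfShift w ∈ Ga.Fld ∧ Ga.po w (halfShift w) ∧ Ga.po (halfShift w) e := by
  have hE : halfShift w ∈ Ga.E := by
    rw [S.corr.events]
    exact Or.inr ⟨w, hw, rfl⟩
  obtain ⟨hwE, o, x, v, hlab⟩ := hw
  cases w with
  | init y => simp [S.wf.init_lab y hwE] at hlab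
  | ev i n =>
    cases e with
    | init y => exact hwe.2.2.elim
    | ev j m =>
      obtain ⟨k, rfl⟩ := S.sn i n hwE
      obtain ⟨l, rfl⟩ := S.sn j m hwe.2.1
      obtain ⟨rfl, hlt⟩ := hwe.2.2
      have hkl : (k : ℚ) + 1 ≤ l := by exact_mod_cast hlt
      refine ⟨⟨hE, S.corr.lab_new _ hE fun hG => ?_⟩, ⟨S.mem_E hwE, hE, rfl, ?_⟩,
        hE, S.mem_E hwe.2.1, rfl, ?_⟩
      · obtain ⟨t, ht⟩ := S.sn i _ hG
        have h2 : (2 : ℚ) * k + 1 = 2 * t := by linarith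
        have h3 : 2 * k + 1 = 2 * t := by exact_mod_cast h2
        omega
      · linarith
      · linarith

/-- Edges of `ar` are either `fob` paths into reads and fences, or follow program order in such a
way that they become `fob` paths when prefixed by a read or a fence. -/
theorem ar_cases (S : ArmRefinement G Ga) {a b : Event} (h : G.ar a b) :
    (b ∈ G.R ∪ G.F ∧ TransGen Ga.fob a b) ∨
      (G.po a b ∧ ∀ m ∈ G.R ∪ G.F, (m = a ∨ G.po m a) →
        TransGen Ga.fob m b ∨ TransGen Ga.fob a b) := by
  have prefixed : ∀ {a b}, G.po a b → (∀ m ∈ G.R, (m = a ∨ G.po m a) → G.po m b →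
      TransGen Ga.fob m b ∨ TransGen Ga.fob a b) →
      (G.po a b ∧ ∀ m ∈ G.R ∪ G.F, (m = a ∨ G.po m a) →
        TransGen Ga.fob m b ∨ TransGen Ga.fob a b) := by
    intro a b hab h
    refine ⟨hab, fun m hm hma => ?_⟩
    have hmb : G.po m b := by
      rcases hma with rfl | hma
      · exact hab
      · exact G.po_trans hma hab
    rcases hm with hm | hm
    · exact h m hm hma hmb
    · exact Or.inl (S.fob_of_fence_po (S.F_Fence hm) hmb)
  rcases h with ((((h | h) | h) | h) | h) | h
  · exact Or.inl ⟨Or.inl (S.wf.rf_sub _ _ h.1).2.1, S.fob_of_rfe h.1 h.2⟩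
  · right
    rcases h with (((⟨c, hab, rfl, hb⟩ | ⟨c, ⟨rfl, ha⟩, hab⟩) | ⟨c, hab, rfl, hb⟩) |
      ⟨c, ⟨rfl, ha⟩, hab⟩) | ⟨c, ⟨rfl, ha⟩, d, hab, rfl, hb⟩
    · exact prefixed hab fun m _ _ hmb => Or.inl (.single (Or.inl
        (AExec.ob_of_WL (S.po_of_po hmb) (S.Wrel_WL hb) (Or.inl rfl))))
    · exact prefixed hab fun m _ _ _ => Or.inr (.single (Or.inl
        (AExec.ob_of_RQ (S.Racq_RQ ha) (S.po_of_po hab))))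
    · exact prefixed hab fun m hm _ hmb => Or.inl (S.fob_of_read_po_fence hm (S.F_Fence hb) hmb)
    · exact prefixed hab fun m _ _ _ => Or.inr (S.fob_of_fence_po (S.F_Fence ha) hab)
    · have haW : a ∈ G.W := S.W_eq ▸ AExec.WL_subset_W (S.Wrel_WL ha)
      refine prefixed hab.1 fun m hm hma _ => Or.inl (.single (Or.inl ?_))
      rcases hma with rfl | hma
      · exact (disjoint_RW hm haW).elim
      · exact AExec.ob_of_WL (S.po_of_po hma) (S.Wrel_WL ha)
          (Or.inr (S.coi_of_coi (S.coi_of_poloc haW hb hab.1 hab.2)))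
  · exact Or.inr (prefixed (S.ppo_po h) fun m _ _ _ => Or.inr (S.fob_of_ppo h))
  · obtain ⟨⟨c, hac, hcb⟩, -⟩ := h
    exact Or.inl ⟨Or.inl (S.wf.rf_sub _ _ hcb.1).2.1,
      (S.fob_of_rfe hcb.1 hcb.2).head (Or.inl (AExec.ob_of_coe (S.coe_of_not_po hac.1 hac.2)))⟩
  · refine Or.inl ⟨Or.inr ?_, S.fob_of_psc h⟩
    obtain ⟨c, -, x, -, y, -, d, -, rfl, hb⟩ := h
    exact ⟨hb.1, _, hb.2⟩
  · obtain ⟨c, ⟨rfl, ha⟩, d, hab, rfl, hb⟩ := h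
    refine Or.inr (prefixed hab fun m hm hma _ => Or.inl (.single (Or.inl ?_)))
    obtain ⟨hF, haf, hfb⟩ := S.strong_fence ha hab
    rcases hma with rfl | hma
    · obtain ⟨hE, o, x, v, hlab⟩ := ha
      exact (disjoint_RW hm ⟨hE, o, x, v, _, hlab⟩).elim
    · exact AExec.ob_of_Fld (S.R_eq ▸ hm) (AExec.po_trans (S.po_of_po hma) haf) hF hfb

theorem ar_acyclic (S : ArmRefinement G Ga) : acyclic G.ar := by
  refine acyclic_of_no_cycle_at (lt := G.po) (P := G.R ∪ G.F)
    (fun a => G.po_irrefl) (fun a b c => G.po_trans) ?_ ?_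
  · intro a b h
    rcases S.ar_cases h with h | h
    · exact Or.inl h.1
    · exact Or.inr h.1
  intro a ha hcyc
  have step : ∀ b c m, m ∈ G.R ∪ G.F → (m = b ∨ G.po m b) → ReflTransGen Ga.fob a m →
      ReflTransGen Ga.fob a b → G.ar b c → TransGen Ga.fob a c ∧
        ∃ m ∈ G.R ∪ G.F, (m = c ∨ G.po m c) ∧ ReflTransGen Ga.fob a m := by
    intro b c m hm hmb ham hab hbc
    rcases S.ar_cases hbc with ⟨hc, hbc⟩ | ⟨hp, hbc⟩
    · have hac := TransGen.trans_right hab hbc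
      exact ⟨hac, c, hc, Or.inl rfl, hac.to_reflTransGen⟩
    · refine ⟨?_, m, hm, Or.inr ?_, ham⟩
      · exact (hbc m hm hmb).elim (TransGen.trans_right ham) (TransGen.trans_right hab)
      · rcases hmb with rfl | hmb
        · exact hp
        · exact G.po_trans hmb hp
  have key : ∀ b, TransGen G.ar a b → TransGen Ga.fob a b ∧
      ∃ m ∈ G.R ∪ G.F, (m = b ∨ G.po m b) ∧ ReflTransGen Ga.fob a m := by
    intro b hb
    induction hb with
    | single h => exact step _ _ a ha (Or.inl rfl) .refl .refl h
    | tail _ h ih =>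
      obtain ⟨hab, m, hm, hmb, ham⟩ := ih
      exact step _ _ m hm hmb ham hab.to_reflTransGen h
  exact S.fob_irrefl (key a hcyc).1

theorem atomicity (S : ArmRefinement G Ga)
    {a b : Event} (h : G.rmw a b) : ¬ (G.fre ⬝ G.coe) a b := by
  rintro ⟨c, hac, hcb⟩
  exact S.cons.2.2.2.2 a b (S.corr.rmw_eq ▸ h)
    ⟨c, S.fre_of_not_po hac.1 hac.2, S.coe_of_not_po hcb.1 hcb.2⟩

theorem rf_complete (S : ArmRefinement G Ga) : rcodom G.rf = G.R := by
  rw [← S.R_eq, ← S.corr.rf_eq]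
  exact S.cons.1

end ArmRefinement

/-- Theorem 4.3: if `G` is an IMM execution graph with whole serial
numbers and `Ga` is an ARM execution graph corresponding to `G`, then
ARM-consistency of `Ga` implies IMM-consistency of `G`. -/
theorem imm_to_arm (G : Execution) (Ga : AExec)
    (hwf : ExecWf G) (hwfa : AExecWf Ga)
    (hsn : wholeSn G)
    (hcorr : ArmCorr G Ga) :
    ARMConsistent Ga → IMMConsistent G := by
  intro hcons
  have S : ArmRefinement G Ga := ⟨hwf, hwfa, hsn, hcorr, hcons⟩
  exact ⟨S.rf_complete, S.co_total, S.coherence, fun _ _ => S.atomicity, S.ar_acyclic⟩
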